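/- arXiv:1112.2581 — 5 statements merged into one kernel-verified Lean document; each statement's English description precedes it below -/
import Mathlib

section
/- Let λ : ℕ → ℝ be a summable sequence with 0 ≤ λ_i ≤ 1 for all i, and for each k ∈ ℕ set p_k := Σ_{I ⊆ ℕ finite, |I| = k} (Π_{i∈I} λ_i) · (Π_{j∉I} (1 − λ_j)), where the product over the complement is a convergent infinite product. Then for every t ∈ [0,1] one has Σ_{k∈ℕ} t^k · p_k = Π_{i∈ℕ} (1 + (t−1)·λ_i). -/
open Filter Topology in
/-- Expansion of the infinite product `∏' i, (f i + g i)` as a sum over finite subsets, for `f`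
absolutely summable and `g` bounded by one and absolutely summably close to one. -/
theorem hasSum_finset_prod_mul_tprod_compl {ι R : Type*} [NormedCommRing R] [NormOneClass R]
    [CompleteSpace R] {f g : ι → R} (hf : Summable fun i ↦ ‖f i‖) (hg : ∀ i, ‖g i‖ ≤ 1)
    (hg_sub : Summable fun i ↦ ‖g i - 1‖) :
    HasSum (fun I : Finset ι ↦ (∏ i ∈ I, f i) * ∏' j : {j : ι // j ∉ I}, g j)
      (∏' i, (f i + g i)) := by
  classical
  have hmul : Multipliable fun i ↦ f i + g i := by
    have h : Summable fun i ↦ ‖f i + (g i - 1)‖ :=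
      (hf.add hg_sub).of_nonneg_of_le (fun _ ↦ norm_nonneg _) fun _ ↦ norm_add_le _ _
    exact (multipliable_one_add_of_summable h).congr fun i ↦ by ring
  have hcompl (I : Finset ι) : Tendsto (fun s : Finset ι ↦ ∏ i ∈ s \ I, g i) atTop
      (𝓝 (∏' j : {j : ι // j ∉ I}, g j)) := by
    have h : Multipliable fun j : {j : ι // j ∉ I} ↦ g j :=
      (multipliable_one_add_of_summable (f := fun j : {j : ι // j ∉ I} ↦ g j - 1)
        (hg_sub.subtype {j | j ∉ I})).congr fun j ↦ by ring
    have h' : HasProd (Set.mulIndicator {j | j ∉ I} g) (∏' j : {j : ι // j ∉ I}, g j) :=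
      hasProd_subtype_iff_mulIndicator.mp h.hasProd
    refine Tendsto.congr (fun s ↦ ?_) h'
    rw [Finset.sdiff_eq_filter, Finset.prod_filter]
    simp [Set.mulIndicator_apply]
  have hbound : Summable fun I : Finset ι ↦ ∏ i ∈ I, ‖f i‖ :=
    summable_finsetProd_of_summable_nonneg (fun _ ↦ norm_nonneg _) hf
  have hle (s I : Finset ι) : ‖(∏ i ∈ I, f i) * ∏ i ∈ s \ I, g i‖ ≤ ∏ i ∈ I, ‖f i‖ := by
    refine (norm_mul_le _ _).trans ?_
    have h : ‖∏ i ∈ s \ I, g i‖ ≤ 1 :=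
      (Finset.norm_prod_le _ _).trans
        (Finset.prod_le_one (fun _ _ ↦ norm_nonneg _) fun i _ ↦ hg i)
    exact (mul_le_of_le_one_right (norm_nonneg _) h).trans (Finset.norm_prod_le _ _)
  have hlim (I : Finset ι) :
      Tendsto (fun s : Finset ι ↦ (∏ i ∈ I, f i) * ∏ i ∈ s \ I, g i) atTop
        (𝓝 ((∏ i ∈ I, f i) * ∏' j : {j : ι // j ∉ I}, g j)) := (hcompl I).const_mul _
  have hsum : Summable fun I : Finset ι ↦ (∏ i ∈ I, f i) * ∏' j : {j : ι // j ∉ I}, g j :=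
    hbound.of_norm_bounded fun I ↦ le_of_tendsto (hlim I).norm (.of_forall fun s ↦ hle s I)
  have hdom : Tendsto
      (fun s : Finset ι ↦ ∑' I, if I ⊆ s then (∏ i ∈ I, f i) * ∏ i ∈ s \ I, g i else 0) atTop
      (𝓝 (∑' I : Finset ι, (∏ i ∈ I, f i) * ∏' j : {j : ι // j ∉ I}, g j)) := by
    refine tendsto_tsum_of_dominated_convergence hbound (fun I ↦ ?_) (.of_forall fun s I ↦ ?_)
    · refine (hlim I).congr' ?_
      filter_upwards [eventually_ge_atTop I] with s hs
      rw [if_pos hs]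
    · split_ifs
      · exact hle s I
      · simpa using Finset.prod_nonneg fun i _ ↦ norm_nonneg (f i)
  have hfin (s : Finset ι) :
      (∑' I, if I ⊆ s then (∏ i ∈ I, f i) * ∏ i ∈ s \ I, g i else 0) = ∏ i ∈ s, (f i + g i) := by
    rw [Finset.prod_add, tsum_eq_sum (s := s.powerset) fun I hI ↦
      if_neg (by simpa using hI)]
    exact Finset.sum_congr rfl fun I hI ↦ if_pos (Finset.mem_powerset.mp hI)
  simp_rw [hfin] at hdom
  rw [← tendsto_nhds_unique hdom hmul.hasProd]
  exact hsum.hasSum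


/-- For a summable sequence `λ : ℕ → [0,1]`, with
`p k = ∑_{I ⊆ ℕ finite, |I| = k} (∏_{i ∈ I} λ i) (∏_{j ∉ I} (1 - λ j))`,
one has `∑ k, t ^ k * p k = ∏' i, (1 + (t - 1) * λ i)` for every `t ∈ [0,1]`. -/
theorem stmt1 (lam : ℕ → ℝ) (hsum : Summable lam)
    (hlam : ∀ i, 0 ≤ lam i ∧ lam i ≤ 1) (p : ℕ → ℝ)
    (hp : ∀ k, p k =
      ∑' I : {s : Finset ℕ // s.card = k},
        (∏ i ∈ (I : Finset ℕ), lam i) *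
          (∏' j : {j : ℕ // j ∉ (I : Finset ℕ)}, (1 - lam (j : ℕ))))
    (t : ℝ) (ht : t ∈ Set.Icc (0 : ℝ) 1) :
    (∑' k : ℕ, t ^ k * p k) = ∏' i : ℕ, (1 + (t - 1) * lam i) := by
  have hf : Summable fun i ↦ ‖t * lam i‖ := (hsum.mul_left t).norm
  have hg (i : ℕ) : ‖1 - lam i‖ ≤ 1 := by
    rw [Real.norm_eq_abs, abs_le]
    constructor <;> linarith [(hlam i).1, (hlam i).2]
  have hg_sub : Summable fun i ↦ ‖1 - lam i - 1‖ := by simpa using hsum.norm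
  have h := hasSum_finset_prod_mul_tprod_compl hf hg hg_sub
  have hprod : ∏' i, (1 + (t - 1) * lam i) = ∏' i, (t * lam i + (1 - lam i)) :=
    tprod_congr fun i ↦ by ring
  rw [hprod, ← (h.tsum_fiberwise Finset.card).tsum_eq]
  refine tsum_congr fun k ↦ ?_
  rw [hp k, ← tsum_mul_left]
  refine tsum_congr fun ⟨I, hI⟩ ↦ ?_
  change I.card = k at hI
  rw [Finset.prod_mul_distrib, Finset.prod_const, hI, mul_assoc]
end

section
/- Let α, b ∈ ℝ with α² + b² = 1 and let t ≥ 0. Consider the real 2×2 matrices A := [[α², −α·b], [−α·b, b²]] and B := [[1, 0], [0, e^{−2t}]]. Then the matrix (1 + (e^{2t} − 1)·b²)·B − A is positive semidefinite. -/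
/-- For `α² + b² = 1` and `t ≥ 0`, with `A = [[α², -αb],[-αb, b²]]` and
`B = [[1,0],[0,e^{-2t}]]`, the matrix `(1 + (e^{2t} - 1) b²) • B - A` is
positive semidefinite. -/
theorem stmt4 (a b t : ℝ) (hab : a ^ 2 + b ^ 2 = 1) (ht : 0 ≤ t)
    (A B : Matrix (Fin 2) (Fin 2) ℝ)
    (hA : A = !![a ^ 2, -(a * b); -(a * b), b ^ 2])
    (hB : B = !![1, 0; 0, Real.exp (-2 * t)]) :
    ((1 + (Real.exp (2 * t) - 1) * b ^ 2) • B - A).PosSemidef := by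
  have h_rank_one : (1 + (Real.exp (2 * t) - 1) * b ^ 2) • B - A =
      Matrix.vecMulVec ![Real.exp t * b, Real.exp (-t) * a]
        (star ![Real.exp t * b, Real.exp (-t) * a]) := by
    have h_inv : Real.exp t * Real.exp (-t) = 1 := by rw [← Real.exp_add]; simp
    have h_sq : Real.exp (2 * t) = Real.exp t ^ 2 := by rw [← Real.exp_nat_mul]; norm_num
    have h_neg_sq : Real.exp (-2 * t) = Real.exp (-t) ^ 2 := by
      rw [← Real.exp_nat_mul]; congr 1; push_cast; ring
    rw [hA, hB, h_sq, h_neg_sq]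
    generalize Real.exp t = u at h_inv ⊢
    generalize Real.exp (-t) = v at h_inv ⊢
    ext i j
    fin_cases i <;> fin_cases j <;> simp [Matrix.vecMulVec_apply] <;> grind
  rw [h_rank_one]
  exact Matrix.posSemidef_vecMulVec_self_star _
end

section
/- For every β ≥ 0 one has 4e^{3β} + 7e^{β} − 8 > 0 and 3(e^{β} − 1) ≤ 0.0942 · (4e^{3β} + 7e^{β} − 8); moreover there exists β ≥ 0 (for instance β ≈ 0.36443) with 3(e^{β} − 1) ≥ 0.0941 · (4e^{3β} + 7e^{β} − 8). In particular the supremum a := sup_{β≥0} 3(e^{β}−1)/(4e^{3β}+7e^{β}−8) satisfies 0.0941 ≤ a ≤ 0.0942. -/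
theorem Real.exp_three_mul_eq_pow (β : ℝ) : Real.exp (3 * β) = Real.exp β ^ 3 := by
  simpa using Real.exp_nat_mul β 3

/-- The upper bound in the variable `x = e^β`; the minimizer of the cubic is near `1.439`. -/
theorem three_mul_sub_one_le_cubic {x : ℝ} (hx : 1 ≤ x) :
    3 * (x - 1) ≤ 0.0942 * (4 * x ^ 3 + 7 * x - 8) := by
  have h : 0 ≤ (x - 1.439) ^ 2 * (x + 2.878) :=
    mul_nonneg (sq_nonneg _) (by linarith)
  nlinarith

theorem cubic_pos {x : ℝ} (hx : 1 ≤ x) : 0 < 4 * x ^ 3 + 7 * x - 8 := by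
  have h : 1 ≤ x ^ 3 := one_le_pow₀ hx
  linarith

/-- For every `β ≥ 0`, `4e^{3β} + 7e^{β} - 8 > 0` and
`3(e^{β} - 1) ≤ 0.0942 (4e^{3β} + 7e^{β} - 8)`; moreover there is `β ≥ 0`
with `3(e^{β} - 1) ≥ 0.0941 (4e^{3β} + 7e^{β} - 8)`. In particular the
supremum `a` of `3(e^{β}-1)/(4e^{3β}+7e^{β}-8)` over `β ≥ 0` satisfies
`0.0941 ≤ a ≤ 0.0942`. -/
theorem stmt5 :
    (∀ β : ℝ, 0 ≤ β →
        0 < 4 * Real.exp (3 * β) + 7 * Real.exp β - 8 ∧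
        3 * (Real.exp β - 1) ≤
          0.0942 * (4 * Real.exp (3 * β) + 7 * Real.exp β - 8)) ∧
    (∃ β : ℝ, 0 ≤ β ∧
        3 * (Real.exp β - 1) ≥
          0.0941 * (4 * Real.exp (3 * β) + 7 * Real.exp β - 8)) ∧
    (0.0941 ≤ sSup ((fun β : ℝ =>
          3 * (Real.exp β - 1) / (4 * Real.exp (3 * β) + 7 * Real.exp β - 8)) ''
          Set.Ici (0 : ℝ)) ∧
      sSup ((fun β : ℝ =>
          3 * (Real.exp β - 1) / (4 * Real.exp (3 * β) + 7 * Real.exp β - 8)) ''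
          Set.Ici (0 : ℝ)) ≤ 0.0942) := by
  have upper : ∀ β : ℝ, 0 ≤ β →
      0 < 4 * Real.exp (3 * β) + 7 * Real.exp β - 8 ∧
      3 * (Real.exp β - 1) ≤
        0.0942 * (4 * Real.exp (3 * β) + 7 * Real.exp β - 8) := by
    intro β hβ
    have hx : 1 ≤ Real.exp β := Real.one_le_exp hβ
    rw [Real.exp_three_mul_eq_pow]
    exact ⟨cubic_pos hx, three_mul_sub_one_le_cubic hx⟩
  have lower : ∃ β : ℝ, 0 ≤ β ∧
      3 * (Real.exp β - 1) ≥
        0.0941 * (4 * Real.exp (3 * β) + 7 * Real.exp β - 8) := by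
    refine ⟨Real.log 1.44, Real.log_nonneg (by norm_num), ?_⟩
    rw [Real.exp_three_mul_eq_pow, Real.exp_log (by norm_num)]
    norm_num
  have bound : ∀ y ∈ (fun β : ℝ =>
      3 * (Real.exp β - 1) / (4 * Real.exp (3 * β) + 7 * Real.exp β - 8)) ''
      Set.Ici (0 : ℝ), y ≤ 0.0942 := by
    rintro _ ⟨β, hβ, rfl⟩
    exact (div_le_iff₀ (upper β hβ).1).2 (upper β hβ).2
  refine ⟨upper, lower, ?_, csSup_le (Set.nonempty_Ici.image _) bound⟩
  obtain ⟨β, hβ, h⟩ := lower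
  exact le_csSup_of_le ⟨_, bound⟩ ⟨β, hβ, rfl⟩ ((le_div_iff₀ (upper β hβ).1).2 h)
end

section
/- Let U : ℝ³ → M₄(ℂ) be defined by U(p) := a₊(p)·I₄ + a₋(p)·β·(α·p)/|p| for p ≠ 0 and U(0) := I₄, where E(p) = √(1+|p|²), a₊(p) = √((E(p)+1)/(2E(p))), a₋(p) = √((E(p)−1)/(2E(p))). Then for all p, k ∈ ℝ³, the operator norm (induced by the ℓ² norm on ℂ⁴) satisfies ‖U(p+k) − U(p)‖ ≤ (7/√2)·|k|. -/
open Matrix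

/-- The Pauli matrices. -/
def pauli1 : Matrix (Fin 2) (Fin 2) ℂ := !![0, 1; 1, 0]
def pauli2 : Matrix (Fin 2) (Fin 2) ℂ := !![0, -Complex.I; Complex.I, 0]
def pauli3 : Matrix (Fin 2) (Fin 2) ℂ := !![1, 0; 0, -1]

/-- The Dirac matrices `α₁, α₂, α₃` in 2×2 block form. -/
def diracAlpha1 : Matrix (Fin 2 ⊕ Fin 2) (Fin 2 ⊕ Fin 2) ℂ :=
  Matrix.fromBlocks 0 pauli1 pauli1 0
def diracAlpha2 : Matrix (Fin 2 ⊕ Fin 2) (Fin 2 ⊕ Fin 2) ℂ :=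
  Matrix.fromBlocks 0 pauli2 pauli2 0
def diracAlpha3 : Matrix (Fin 2 ⊕ Fin 2) (Fin 2 ⊕ Fin 2) ℂ :=
  Matrix.fromBlocks 0 pauli3 pauli3 0

/-- The Dirac matrix `β` in 2×2 block form. -/
def diracBeta : Matrix (Fin 2 ⊕ Fin 2) (Fin 2 ⊕ Fin 2) ℂ :=
  Matrix.fromBlocks 1 0 0 (-1)

/-- `α·p = p₁α₁ + p₂α₂ + p₃α₃`. -/
noncomputable def alphaDot (p : Fin 3 → ℝ) : Matrix (Fin 2 ⊕ Fin 2) (Fin 2 ⊕ Fin 2) ℂ :=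
  (p 0 : ℂ) • diracAlpha1 + (p 1 : ℂ) • diracAlpha2 + (p 2 : ℂ) • diracAlpha3

/-- `E(p) = √(1+|p|²)`. -/
noncomputable def diracE (p : Fin 3 → ℝ) : ℝ :=
  Real.sqrt (1 + (p 0 ^ 2 + p 1 ^ 2 + p 2 ^ 2))

/-- The Foldy–Wouthuysen rotation `U(p)`, extended by `U(0) = I₄`. -/
noncomputable def fwU (p : Fin 3 → ℝ) : Matrix (Fin 2 ⊕ Fin 2) (Fin 2 ⊕ Fin 2) ℂ :=
  if p = 0 then 1 else
    ((Real.sqrt ((diracE p + 1) / (2 * diracE p)) : ℝ) : ℂ) • 1 +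
      ((Real.sqrt ((diracE p - 1) / (2 * diracE p)) /
          Real.sqrt (p 0 ^ 2 + p 1 ^ 2 + p 2 ^ 2) : ℝ) : ℂ) • (diracBeta * alphaDot p)

theorem norm_toEuclideanCLM_sq_le {n : Type*} [Fintype n] [DecidableEq n] {M : Matrix n n ℂ}
    {r : ℝ} (hr : 0 ≤ r) (h : Mᴴ * M = (r : ℂ) • 1) :
    ‖Matrix.toEuclideanCLM (𝕜 := ℂ) M‖ ^ 2 ≤ r := by
  have h1 : star (Matrix.toEuclideanCLM (𝕜 := ℂ) M) * Matrix.toEuclideanCLM (𝕜 := ℂ) M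
      = (r : ℂ) • 1 := by
    rw [← map_star, ← map_mul, Matrix.star_eq_conjTranspose, h, map_smul, map_one]
  rw [sq, ← CStarRing.norm_star_mul_self, h1, norm_smul, Complex.norm_real, Real.norm_of_nonneg hr]
  exact mul_le_of_le_one_right hr ContinuousLinearMap.norm_id_le

theorem conjTranspose_mul_self_smul_one_add_beta_alphaDot (c : ℝ) (v : Fin 3 → ℝ) :
    ((c : ℂ) • 1 + diracBeta * alphaDot v)ᴴ * ((c : ℂ) • 1 + diracBeta * alphaDot v) =
      ((c ^ 2 + (v 0 ^ 2 + v 1 ^ 2 + v 2 ^ 2) : ℝ) : ℂ) • 1 := by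
  have hβ : diracBeta * alphaDot v = Matrix.fromBlocks 0
      !![(v 2 : ℂ), v 0 - v 1 * Complex.I; v 0 + v 1 * Complex.I, -v 2]
      (-!![(v 2 : ℂ), v 0 - v 1 * Complex.I; v 0 + v 1 * Complex.I, -v 2]) 0 := by
    ext (i | i) (j | j) <;> fin_cases i <;> fin_cases j <;>
      simp [diracBeta, alphaDot, diracAlpha1, diracAlpha2, diracAlpha3, pauli1, pauli2, pauli3,
        Matrix.fromBlocks_smul, Matrix.fromBlocks_add, Matrix.fromBlocks_multiply] <;> ring
  rw [hβ, ← Matrix.fromBlocks_one, Matrix.fromBlocks_smul, Matrix.fromBlocks_add,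
    Matrix.fromBlocks_conjTranspose, Matrix.fromBlocks_multiply, Matrix.fromBlocks_smul]
  have hI := Complex.I_sq
  ext (i | i) (j | j) <;> fin_cases i <;> fin_cases j <;>
    simp [Matrix.mul_apply, Fin.sum_univ_two] <;> ring_nf <;> simp [hI]

theorem one_le_diracE (p : Fin 3 → ℝ) : 1 ≤ diracE p :=
  Real.one_le_sqrt.mpr (le_add_of_nonneg_right (by positivity))

theorem diracE_sq (p : Fin 3 → ℝ) : diracE p ^ 2 = 1 + (p 0 ^ 2 + p 1 ^ 2 + p 2 ^ 2) :=
  Real.sq_sqrt (by positivity)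

theorem one_add_dot_le_diracE_mul (p q : Fin 3 → ℝ) :
    1 + (p 0 * q 0 + p 1 * q 1 + p 2 * q 2) ≤ diracE p * diracE q := by
  have hp := one_le_diracE p
  have hq := one_le_diracE q
  refine (abs_le_of_sq_le_sq' ?_ (by positivity)).2
  rw [mul_pow, diracE_sq, diracE_sq]
  nlinarith [sq_nonneg (p 0 - q 0), sq_nonneg (p 1 - q 1), sq_nonneg (p 2 - q 2),
    sq_nonneg (p 0 * q 1 - p 1 * q 0), sq_nonneg (p 0 * q 2 - p 2 * q 0),
    sq_nonneg (p 1 * q 2 - p 2 * q 1)]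

/-- The norm of the vector `(E(p) + 1, p)`, of which `U(p)` is the normalization. -/
noncomputable def fwNorm (p : Fin 3 → ℝ) : ℝ :=
  Real.sqrt (2 * diracE p * (diracE p + 1))

theorem fwNorm_sq (p : Fin 3 → ℝ) : fwNorm p ^ 2 = 2 * diracE p * (diracE p + 1) := by
  have hp := one_le_diracE p
  exact Real.sq_sqrt (by positivity)

theorem two_le_fwNorm (p : Fin 3 → ℝ) : 2 ≤ fwNorm p := by
  have hp := one_le_diracE p
  exact Real.le_sqrt_of_sq_le (by nlinarith)

theorem fwU_eq (p : Fin 3 → ℝ) :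
    fwU p = (((diracE p + 1) / fwNorm p : ℝ) : ℂ) • 1 +
      ((1 / fwNorm p : ℝ) : ℂ) • (diracBeta * alphaDot p) := by
  have hE := one_le_diracE p
  have hN := two_le_fwNorm p
  have hE2 := diracE_sq p
  have hN2 := fwNorm_sq p
  by_cases hp : p = 0
  · subst hp
    have hE1 : diracE 0 = 1 := by simp [diracE]
    have hN1 : fwNorm 0 = 2 := by
      rw [hE1] at hN2
      nlinarith
    simp [fwU, alphaDot, hE1, hN1]
  · have hs : 0 < p 0 ^ 2 + p 1 ^ 2 + p 2 ^ 2 := by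
      obtain ⟨i, hi⟩ := Function.ne_iff.mp hp
      have := sq_pos_of_ne_zero hi
      fin_cases i <;> simp at this <;> positivity
    have ha : Real.sqrt ((diracE p + 1) / (2 * diracE p)) = (diracE p + 1) / fwNorm p := by
      rw [← Real.sqrt_sq (by positivity : 0 ≤ (diracE p + 1) / fwNorm p), div_pow, hN2]
      congr 1
      field_simp
    have hb : Real.sqrt ((diracE p - 1) / (2 * diracE p)) /
        Real.sqrt (p 0 ^ 2 + p 1 ^ 2 + p 2 ^ 2) = 1 / fwNorm p := by
      rw [← Real.sqrt_div' _ hs.le, ← Real.sqrt_sq (by positivity : 0 ≤ 1 / fwNorm p), div_pow, hN2]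
      congr 1
      field_simp
      linarith
    rw [fwU, if_neg hp, ha, hb]

theorem fwU_sub (p q : Fin 3 → ℝ) :
    fwU q - fwU p = (((diracE q + 1) / fwNorm q - (diracE p + 1) / fwNorm p : ℝ) : ℂ) • 1 +
      diracBeta * alphaDot (fun i => q i / fwNorm q - p i / fwNorm p) := by
  have h : alphaDot (fun i => q i / fwNorm q - p i / fwNorm p) =
      ((1 / fwNorm q : ℝ) : ℂ) • alphaDot q - ((1 / fwNorm p : ℝ) : ℂ) • alphaDot p := by
    simp only [alphaDot]
    push_cast
    module
  rw [fwU_eq, fwU_eq, h, mul_sub, Matrix.mul_smul, Matrix.mul_smul]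
  push_cast
  module

theorem fwU_dist_sq_le (p q : Fin 3 → ℝ) :
    ((diracE q + 1) / fwNorm q - (diracE p + 1) / fwNorm p) ^ 2 +
      ((q 0 / fwNorm q - p 0 / fwNorm p) ^ 2 + (q 1 / fwNorm q - p 1 / fwNorm p) ^ 2 +
        (q 2 / fwNorm q - p 2 / fwNorm p) ^ 2) ≤
      ((q 0 - p 0) ^ 2 + (q 1 - p 1) ^ 2 + (q 2 - p 2) ^ 2) / 2 := by
  have hp := two_le_fwNorm p
  have hq := two_le_fwNorm q
  have hp2 := fwNorm_sq p
  have hq2 := fwNorm_sq q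
  have hEp := diracE_sq p
  have hEq := diracE_sq q
  have hd := one_add_dot_le_diracE_mul p q
  let D := (diracE q + 1) * (diracE p + 1) + (q 0 * p 0 + q 1 * p 1 + q 2 * p 2)
  have hD : D = (diracE q + 1) * (diracE p + 1) + (q 0 * p 0 + q 1 * p 1 + q 2 * p 2) := rfl
  have hL : ((diracE q + 1) / fwNorm q - (diracE p + 1) / fwNorm p) ^ 2 +
      ((q 0 / fwNorm q - p 0 / fwNorm p) ^ 2 + (q 1 / fwNorm q - p 1 / fwNorm p) ^ 2 +
        (q 2 / fwNorm q - p 2 / fwNorm p) ^ 2) =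
      ((diracE q + 1) ^ 2 + (q 0 ^ 2 + q 1 ^ 2 + q 2 ^ 2)) / fwNorm q ^ 2 +
      ((diracE p + 1) ^ 2 + (p 0 ^ 2 + p 1 ^ 2 + p 2 ^ 2)) / fwNorm p ^ 2 -
        2 * D / (fwNorm q * fwNorm p) := by
    rw [hD]
    ring
  have h1 : (diracE q + 1) ^ 2 + (q 0 ^ 2 + q 1 ^ 2 + q 2 ^ 2) = fwNorm q ^ 2 := by linarith
  have h2 : (diracE p + 1) ^ 2 + (p 0 ^ 2 + p 1 ^ 2 + p 2 ^ 2) = fwNorm p ^ 2 := by linarith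
  have hNN : 4 ≤ fwNorm q * fwNorm p := by nlinarith
  rw [hL, h1, h2, div_self (by positivity), div_self (by positivity)]
  have h3 : (1 : ℝ) + 1 - 2 * D / (fwNorm q * fwNorm p) =
      (2 * (fwNorm q * fwNorm p) - 2 * D) / (fwNorm q * fwNorm p) := by
    field_simp
    ring
  rw [h3, div_le_div_iff₀ (by positivity) two_pos]
  have hs : 0 ≤ (q 0 - p 0) ^ 2 + (q 1 - p 1) ^ 2 + (q 2 - p 2) ^ 2 := by positivity
  have h4 : 2 * (fwNorm q * fwNorm p) - 2 * D ≤
      2 * ((q 0 - p 0) ^ 2 + (q 1 - p 1) ^ 2 + (q 2 - p 2) ^ 2) := by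
    have := sq_nonneg (fwNorm q - fwNorm p)
    rw [hD]
    linarith
  linarith [mul_le_mul_of_nonneg_left hNN hs]

/-- The Foldy–Wouthuysen rotation is globally Lipschitz, in the operator norm
induced by the `ℓ²` norm on `ℂ⁴`: `‖U(p+k) - U(p)‖ ≤ (7/√2) |k|`. -/
theorem stmt8 (p k : Fin 3 → ℝ) :
    ‖Matrix.toEuclideanCLM (𝕜 := ℂ) (fwU (p + k) - fwU p)‖ ≤
      7 / Real.sqrt 2 * Real.sqrt (k 0 ^ 2 + k 1 ^ 2 + k 2 ^ 2) := by
  refine (abs_le_of_sq_le_sq' ?_ (by positivity)).2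
  rw [fwU_sub]
  refine (norm_toEuclideanCLM_sq_le (by positivity)
    (conjTranspose_mul_self_smul_one_add_beta_alphaDot _ _)).trans ?_
  refine (fwU_dist_sq_le p (p + k)).trans ?_
  have hk : 0 ≤ k 0 ^ 2 + k 1 ^ 2 + k 2 ^ 2 := by positivity
  rw [mul_pow, div_pow, Real.sq_sqrt hk, Real.sq_sqrt zero_le_two]
  simp only [Pi.add_apply, add_sub_cancel_left]
  linarith
end

section
/- Define f(a,b) := a³·b·( √(2π)·(a·b − 2/3) + (8/9)·a³ ) for a > 0 and 0 < b < 1. Then −2^{−35/6}·3^{2/3}·π^{5/6} is the least element of the set { f(a,b) : a > 0, 0 < b < 1 }; that is, f(a,b) ≥ −2^{−35/6}·3^{2/3}·π^{5/6} for all such a, b, and the value is attained for some a > 0 and b ∈ (0,1). -/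
open Real

/-- The weighted AM-GM inequality `4 a c³ ≤ a⁴ + 3 c⁴`. -/
lemma four_mul_mul_cube_le (a c : ℝ) : 4 * a * c ^ 3 ≤ a ^ 4 + 3 * c ^ 4 := by
  have h : a ^ 4 + 3 * c ^ 4 - 4 * a * c ^ 3
      = (a - c) ^ 2 * ((a + c) ^ 2 + 2 * c ^ 2) := by ring
  have h' : 0 ≤ (a - c) ^ 2 * ((a + c) ^ 2 + 2 * c ^ 2) := by positivity
  linarith

/-- The lower bound, with `√(2π)` written as `16 c³ / 3`. -/
lemma neg_pow_five_div_three_le {a b c : ℝ} (ha : 0 < a) (hb : 0 < b) (hc : 0 < c) :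
    -(c ^ 5 / 3) ≤ a ^ 3 * b * (16 * c ^ 3 / 3 * (a * b - 2 / 3) + 8 / 9 * a ^ 3) := by
  set p := a * (4 / 3 * c ^ 3 - a ^ 3 / 3) with hp
  have key : 0 ≤ (4 * c ^ 3 * a * (a * b)) ^ 2 - 2 * (4 * c ^ 3 * a * (a * b)) * p + c ^ 8 := by
    have hu : 0 < 4 * c ^ 3 * a * (a * b) := by positivity
    rcases le_or_gt p 0 with h | h
    · have := mul_nonneg hu.le (neg_nonneg.2 h)
      have : 0 < c ^ 8 := by positivity
      nlinarith [sq_nonneg (4 * c ^ 3 * a * (a * b))]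
    · have hpc : p ≤ c ^ 4 := by
        have := four_mul_mul_cube_le a c
        rw [hp]
        linarith
      have := pow_le_pow_left₀ h.le hpc 2
      nlinarith [sq_nonneg (4 * c ^ 3 * a * (a * b) - p)]
  have hmul : (4 * c ^ 3 * a * (a * b)) ^ 2 - 2 * (4 * c ^ 3 * a * (a * b)) * p + c ^ 8
      = 3 * c ^ 3 *
        (a ^ 3 * b * (16 * c ^ 3 / 3 * (a * b - 2 / 3) + 8 / 9 * a ^ 3) + c ^ 5 / 3) := by
    rw [hp]
    ring
  rw [hmul] at key
  have := nonneg_of_mul_nonneg_right key (by positivity)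
  linarith

/-- `-2^{-35/6} 3^{2/3} π^{5/6}` is the least value of
`f(a,b) = a³ b (√(2π)(ab - 2/3) + (8/9)a³)` over `a > 0`, `0 < b < 1`. -/
theorem stmt15 :
    IsLeast
      {y : ℝ | ∃ a b : ℝ, 0 < a ∧ 0 < b ∧ b < 1 ∧
        y = a ^ 3 * b * (Real.sqrt (2 * Real.pi) * (a * b - 2 / 3) + 8 / 9 * a ^ 3)}
      (-((2 : ℝ) ^ (-(35 : ℝ) / 6) * (3 : ℝ) ^ ((2 : ℝ) / 3) *
        Real.pi ^ ((5 : ℝ) / 6))) := by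
  have hπ := Real.pi_pos
  obtain ⟨c, hc, hs, hval⟩ : ∃ c : ℝ, 0 < c ∧ √(2 * π) = 16 * c ^ 3 / 3 ∧
      (2 : ℝ) ^ (-(35 : ℝ) / 6) * (3 : ℝ) ^ ((2 : ℝ) / 3) * π ^ ((5 : ℝ) / 6) = c ^ 5 / 3 := by
    refine ⟨(2 : ℝ) ^ (-(7 : ℝ) / 6) * (3 : ℝ) ^ ((1 : ℝ) / 3) * π ^ ((1 : ℝ) / 6),
      by positivity, ?_, ?_⟩
    · rw [mul_pow, mul_pow, ← rpow_mul_natCast (by norm_num), ← rpow_mul_natCast (by norm_num),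
        ← rpow_mul_natCast hπ.le, sqrt_eq_rpow, mul_rpow (by norm_num) hπ.le,
        show (1 / 2 : ℝ) = 4 + -(7 : ℝ) / 6 * (3 : ℕ) by norm_num, rpow_add (by norm_num)]
      norm_num
      ring
    · rw [mul_pow, mul_pow, ← rpow_mul_natCast (by norm_num), ← rpow_mul_natCast (by norm_num),
        ← rpow_mul_natCast hπ.le,
        show (1 : ℝ) / 3 * (5 : ℕ) = 2 / 3 + 1 by norm_num, rpow_add_one (by norm_num)]
      norm_num
      ring
  rw [hs, hval]
  constructor
  · have hquarter : 1 / 4 < c := by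
      have h1 : 1 ≤ √(2 * π) := by
        rw [one_le_sqrt]
        linarith [pi_gt_three]
      refine lt_of_pow_lt_pow_left₀ 3 hc.le ?_
      rw [hs] at h1
      linarith
    refine ⟨c, 1 / (4 * c), hc, by positivity, ?_, ?_⟩
    · rw [div_lt_one (by positivity)]
      linarith
    · field_simp
      ring
  · rintro y ⟨a, b, ha, hb, -, rfl⟩
    exact neg_pow_five_div_three_le ha hb hc
end
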